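/- arXiv:gr-qc/0612098 — 2 statements merged into one kernel-verified Lean document; each statement's English description precedes it below -/
import Mathlib

section
/- The contraction identity (6.66a), (1/2) F n F̃ = (n⌟F)⌟F + (1/2) n (F·F), in explicit form: for every antisymmetric real 4×4 matrix G and every vector x ∈ Fin 4 → ℝ, (1/2) • (Φ * ι Q x * reverse Φ) = ι Q (w' + (s/2) • x), where w is the vector with components w d = ∑_{ρ} η d d * x ρ * G ρ d (the contraction x⌟Φ), w' is the vector with components w' d = ∑_{ρ} η d d * w ρ * G ρ d (the double contraction (x⌟Φ)⌟Φ), and s := (1/2) * ∑_{ρ,σ} η ρ ρ * η σ σ * (G ρ σ)^2 (the scalar F·F). -/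
noncomputable section

open CliffordAlgebra Finset Matrix

/-- The Minkowski metric matrix `diag(1,-1,-1,-1)`. -/
def η : Matrix (Fin 4) (Fin 4) ℝ := Matrix.diagonal ![1, -1, -1, -1]

/-- The Minkowski quadratic form on `Fin 4 → ℝ`:
`Q x = (x 0)^2 - (x 1)^2 - (x 2)^2 - (x 3)^2`. -/
def Q : QuadraticForm ℝ (Fin 4 → ℝ) :=
  QuadraticMap.weightedSumSquares ℝ ![(1 : ℝ), -1, -1, -1]

/-- The bilinear form associated with `Q`. -/
def B (x y : Fin 4 → ℝ) : ℝ := (Q (x + y) - Q x - Q y) / 2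

/-- The standard basis of `Fin 4 → ℝ`. -/
def e (a : Fin 4) : Fin 4 → ℝ := Pi.single a 1

/-- The Dirac gamma `γ a = ι Q (e a)`. -/
def γ (a : Fin 4) : CliffordAlgebra Q := ι Q (e a)

/-- The electromagnetic bivector `Φ = (1/2) F_{ab} γ^a γ^b`
(indices raised with `η`). -/
def Φ (G : Matrix (Fin 4) (Fin 4) ℝ) : CliffordAlgebra Q :=
  (1 / 2 : ℝ) • ∑ a : Fin 4, ∑ b : Fin 4, (η a a * η b b * G a b) • (γ a * γ b)

/-- The contraction `x⌟Φ`. -/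
def w (G : Matrix (Fin 4) (Fin 4) ℝ) (x : Fin 4 → ℝ) : Fin 4 → ℝ :=
  fun d => ∑ ρ : Fin 4, η d d * x ρ * G ρ d

/-- The scalar `F·F`. -/
def s (G : Matrix (Fin 4) (Fin 4) ℝ) : ℝ :=
  (1 / 2) * ∑ ρ : Fin 4, ∑ σ : Fin 4, η ρ ρ * η σ σ * (G ρ σ) ^ 2

theorem ι_eq_sum_γ (x : Fin 4 → ℝ) : ι Q x = ∑ a : Fin 4, x a • γ a := by
  conv_lhs => rw [pi_eq_sum_univ' x]
  simp [γ, e, Pi.single]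

theorem γ_mul_self (a : Fin 4) : γ a * γ a = algebraMap ℝ _ (η a a) := by
  rw [γ, ι_sq_scalar]
  congr 1
  fin_cases a <;> simp [Q, η, e, Fin.sum_univ_four, QuadraticMap.weightedSumSquares_apply]

theorem γ_mul_γ_of_ne {a b : Fin 4} (h : a ≠ b) : γ a * γ b = -(γ b * γ a) := by
  refine ι_mul_ι_comm_of_isOrtho ?_
  fin_cases a <;> fin_cases b <;>
    simp_all [QuadraticMap.isOrtho_def, Q, e, Fin.sum_univ_four,
      QuadraticMap.weightedSumSquares_apply]

theorem γ_mul_γ_mul_of_lt {a b : Fin 4} (h : a < b) (z : CliffordAlgebra Q) :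
    γ b * (γ a * z) = -(γ a * (γ b * z)) := by
  rw [← mul_assoc, γ_mul_γ_of_ne h.ne', neg_mul, mul_assoc]

theorem γ_mul_γ_mul_self (a : Fin 4) (z : CliffordAlgebra Q) :
    γ a * (γ a * z) = η a a • z := by
  rw [← mul_assoc, γ_mul_self, Algebra.smul_def]

theorem apply_swap_of_transpose_eq_neg {G : Matrix (Fin 4) (Fin 4) ℝ} (hG : Gᵀ = -G)
    (a b : Fin 4) : G b a = -G a b :=
  congr_fun₂ hG a b

/-- The bivector of an antisymmetric matrix, expanded over the ordered pairs of generators. -/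
theorem Φ_eq (G : Matrix (Fin 4) (Fin 4) ℝ) (hG : Gᵀ = -G) :
    Φ G = -G 0 1 • (γ 0 * γ 1) - G 0 2 • (γ 0 * γ 2) - G 0 3 • (γ 0 * γ 3)
      + G 1 2 • (γ 1 * γ 2) + G 1 3 • (γ 1 * γ 3) + G 2 3 • (γ 2 * γ 3) := by
  have hd (a : Fin 4) : G a a = 0 := by
    linarith [apply_swap_of_transpose_eq_neg hG a a]
  have hs := apply_swap_of_transpose_eq_neg hG
  simp only [Φ, Fin.sum_univ_four, hd, hs 0 1, hs 0 2, hs 0 3, hs 1 2, hs 1 3, hs 2 3,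
    γ_mul_γ_of_ne (show (1 : Fin 4) ≠ 0 by decide), γ_mul_γ_of_ne (show (2 : Fin 4) ≠ 0 by decide),
    γ_mul_γ_of_ne (show (3 : Fin 4) ≠ 0 by decide), γ_mul_γ_of_ne (show (2 : Fin 4) ≠ 1 by decide),
    γ_mul_γ_of_ne (show (3 : Fin 4) ≠ 1 by decide), γ_mul_γ_of_ne (show (3 : Fin 4) ≠ 2 by decide)]
  simp [η]
  module

/-- Reversion negates bivectors. -/
theorem reverse_Φ (G : Matrix (Fin 4) (Fin 4) ℝ) (hG : Gᵀ = -G) :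
    reverse (R := ℝ) (Φ G) = -Φ G := by
  have h : reverse (R := ℝ) (Φ G) = Φ Gᵀ := by
    simp only [Φ, map_smul, map_sum, reverse.map_mul, γ, reverse_ι, transpose_apply]
    rw [sum_comm]
    simp only [mul_comm (η _ _) (η _ _)]
  rw [h, hG]
  simp [Φ]

/-- The contraction identity `(1/2) F n F̃ = (n⌟F)⌟F + (1/2) n (F·F)`. -/
theorem half_sandwich_eq_double_contraction (G : Matrix (Fin 4) (Fin 4) ℝ)
    (hG : Gᵀ = -G) (x : Fin 4 → ℝ) :
    (1 / 2 : ℝ) • (Φ G * ι Q x * reverse (R := ℝ) (Φ G)) =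
      ι Q (w G (w G x) + (s G / 2) • x) := by
  have hd (a : Fin 4) : G a a = 0 := by
    linarith [apply_swap_of_transpose_eq_neg hG a a]
  have hs := apply_swap_of_transpose_eq_neg hG
  have h01 := γ_mul_γ_mul_of_lt (show (0 : Fin 4) < 1 by decide)
  have h02 := γ_mul_γ_mul_of_lt (show (0 : Fin 4) < 2 by decide)
  have h03 := γ_mul_γ_mul_of_lt (show (0 : Fin 4) < 3 by decide)
  have h12 := γ_mul_γ_mul_of_lt (show (1 : Fin 4) < 2 by decide)
  have h13 := γ_mul_γ_mul_of_lt (show (1 : Fin 4) < 3 by decide)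
  have h23 := γ_mul_γ_mul_of_lt (show (2 : Fin 4) < 3 by decide)
  have k01 := γ_mul_γ_of_ne (show (1 : Fin 4) ≠ 0 by decide)
  have k02 := γ_mul_γ_of_ne (show (2 : Fin 4) ≠ 0 by decide)
  have k03 := γ_mul_γ_of_ne (show (3 : Fin 4) ≠ 0 by decide)
  have k12 := γ_mul_γ_of_ne (show (2 : Fin 4) ≠ 1 by decide)
  have k13 := γ_mul_γ_of_ne (show (3 : Fin 4) ≠ 1 by decide)
  have k23 := γ_mul_γ_of_ne (show (3 : Fin 4) ≠ 2 by decide)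
  have η0 : η 0 0 = 1 := by simp [η]
  have η1 : η 1 1 = -1 := by simp [η]
  have η2 : η 2 2 = -1 := by simp [η]
  have η3 : η 3 3 = -1 := by simp [η]
  rw [reverse_Φ G hG, Φ_eq G hG, ι_eq_sum_γ, ι_eq_sum_γ]
  simp only [Fin.sum_univ_four, w, s, Pi.add_apply, Pi.smul_apply, smul_eq_mul, hd,
    hs 0 1, hs 0 2, hs 0 3, hs 1 2, hs 1 3, hs 2 3, η0, η1, η2, η3]
  simp only [sub_eq_add_neg, mul_add, add_mul, neg_mul, mul_neg, smul_mul_assoc, mul_smul_comm,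
    neg_smul, smul_neg, mul_assoc, h01, h02, h03, h12, h13, h23, k01, k02, k03, k12, k13, k23,
    γ_mul_self, γ_mul_γ_mul_self, η0, η1, η2, η3, map_neg, map_one, mul_one, one_smul]
  module
end
end

section
/- Maxwell-like equations for the energy–momentum of a free electromagnetic field (Proposition on the 2-forms 𝒲^a = dΓ^a with d𝒲^a = 0 and δ𝒲^a = −𝒯^a): let A : (Fin 4 → ℝ) → (Fin 4 → ℝ) be smooth (C^∞), define the field strength F x μ ν := ∂_μ (fun y => A y ν) x − ∂_ν (fun y => A y μ) x, and assume the source-free Maxwell equation ∑_μ η μ μ * ∂_μ (fun y => F y μ ν) x = 0 for all ν and all x. Define the energy–momentum tensor T x a b := −∑_c η c c * F x a c * F x b c + (1/4) * (∑_{c,d} η c c * η d d * (F x c d)^2) * η a b. Then for every a ∈ Fin 4 there exists a smooth Γ : (Fin 4 → ℝ) → (Fin 4 → ℝ) such that the exact 2-form field W x μ ν := ∂_μ (fun y => Γ y ν) x − ∂_ν (fun y => Γ y μ) x satisfies, for every ν and every point x, ∑_μ η μ μ * ∂_μ (fun y => W y μ ν) x = T x a ν; that is, each energy–momentum 1-form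 of the free field is the codifferential of an exact 2-form, so these 2-forms satisfy Maxwell-like equations with the energy–momentum 1-forms as sources. -/
noncomputable section

open Matrix

/-- The partial derivative of `f` along the `μ`-th standard basis direction. -/
def pd (μ : Fin 4) (f : (Fin 4 → ℝ) → ℝ) (x : Fin 4 → ℝ) : ℝ :=
  fderiv ℝ f x (Pi.single μ 1)

/-- The exterior derivative of a `1`-form (field strength of a potential). -/
def dPot (A : (Fin 4 → ℝ) → (Fin 4 → ℝ)) (x : Fin 4 → ℝ) (μ ν : Fin 4) : ℝ :=
  pd μ (fun y => A y ν) x - pd ν (fun y => A y μ) x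

/-- The Maxwell energy–momentum tensor of a field strength `F`. -/
def Tem (F : (Fin 4 → ℝ) → Fin 4 → Fin 4 → ℝ) (x : Fin 4 → ℝ) (a b : Fin 4) : ℝ :=
  -∑ c : Fin 4, η c c * F x a c * F x b c
    + (1 / 4) * (∑ c : Fin 4, ∑ d : Fin 4, η c c * η d d * (F x c d) ^ 2) * η a b

open MeasureTheory Set Filter Topology
open scoped ContDiff

section ParametricIntegral

theorem Continuous.integrable_of_ae_mem_compact {P F : Type} [NormedAddCommGroup P]
    [MeasurableSpace P] [BorelSpace P] [SecondCountableTopology P] [NormedAddCommGroup F]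
    {m : Measure P} [IsFiniteMeasure m] {K : Set P} {g : P → F} (hg : Continuous g)
    (hK : IsCompact K) (hm : ∀ᵐ p ∂m, p ∈ K) : Integrable g m := by
  obtain ⟨C, hC⟩ := hK.exists_bound_of_continuousOn hg.continuousOn
  exact Integrable.of_bound hg.aestronglyMeasurable C (hm.mono hC)

variable {P E F : Type} [NormedAddCommGroup P] [NormedSpace ℝ P] [MeasurableSpace P]
  [BorelSpace P] [SecondCountableTopology P] [NormedAddCommGroup E] [NormedSpace ℝ E]
  [ProperSpace E] [NormedAddCommGroup F] [NormedSpace ℝ F]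
  {m : Measure P} [IsFiniteMeasure m] {K : Set P}

theorem hasFDerivAt_integral_of_ae_mem_compact {H : P × E → F} (hH : ContDiff ℝ ∞ H)
    (hK : IsCompact K) (hm : ∀ᵐ p ∂m, p ∈ K) (x : E) :
    HasFDerivAt (fun x => ∫ p, H (p, x) ∂m)
      (∫ p, (fderiv ℝ H (p, x)).comp (ContinuousLinearMap.inr ℝ P E) ∂m) x := by
  have hH' : Continuous fun q : P × E =>
      (fderiv ℝ H q).comp (ContinuousLinearMap.inr ℝ P E) :=
    (hH.continuous_fderiv (by simp)).clm_comp continuous_const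
  obtain ⟨C, hC⟩ := (hK.prod (isCompact_closedBall x 1)).exists_bound_of_continuousOn
    hH'.continuousOn
  refine hasFDerivAt_integral_of_dominated_of_fderiv_le (bound := fun _ => C)
    (Metric.closedBall_mem_nhds x one_pos)
    (Eventually.of_forall fun y =>
      (hH.continuous.comp (Continuous.prodMk_left y)).aestronglyMeasurable)
    ((hH.continuous.comp (Continuous.prodMk_left x)).integrable_of_ae_mem_compact hK hm)
    (hH'.comp (Continuous.prodMk_left x)).aestronglyMeasurable
    (hm.mono fun p hp y hy => hC (p, y) ⟨hp, hy⟩) (integrable_const C)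
    (Eventually.of_forall fun p y _ => ?_)
  have h1 : HasFDerivAt H (fderiv ℝ H (p, y)) (p, y) :=
    (hH.differentiable (by simp) _).hasFDerivAt
  exact h1.comp y (hasFDerivAt_prodMk_right p y)

theorem contDiff_integral_of_ae_mem_compact {H : P × E → F} (hH : ContDiff ℝ ∞ H)
    (hK : IsCompact K) (hm : ∀ᵐ p ∂m, p ∈ K) :
    ContDiff ℝ ∞ (fun x => ∫ p, H (p, x) ∂m) := by
  rw [contDiff_infty]
  intro n
  induction n generalizing F with
  | zero =>
    exact contDiff_zero.2 (continuous_iff_continuousAt.2 fun x =>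
      (hasFDerivAt_integral_of_ae_mem_compact hH hK hm x).continuousAt)
  | succ n ih =>
    push_cast
    have hH' : ContDiff ℝ ∞ fun q : P × E =>
        (fderiv ℝ H q).comp (ContinuousLinearMap.inr ℝ P E) :=
      (hH.fderiv_right (by simp)).clm_comp contDiff_const
    exact contDiff_succ_iff_hasFDerivAt.2
      ⟨_, ih hH', fun x => hasFDerivAt_integral_of_ae_mem_compact hH hK hm x⟩

theorem fderiv_integral_apply_of_ae_mem_compact [CompleteSpace F] {H : P × E → F}
    (hH : ContDiff ℝ ∞ H) (hK : IsCompact K) (hm : ∀ᵐ p ∂m, p ∈ K) (x v : E) :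
    fderiv ℝ (fun x => ∫ p, H (p, x) ∂m) x v = ∫ p, fderiv ℝ (fun y => H (p, y)) x v ∂m := by
  have hH' : Continuous fun p : P =>
      (fderiv ℝ H (p, x)).comp (ContinuousLinearMap.inr ℝ P E) :=
    ((hH.continuous_fderiv (by simp)).comp (Continuous.prodMk_left x)).clm_comp continuous_const
  rw [(hasFDerivAt_integral_of_ae_mem_compact hH hK hm x).fderiv,
    ContinuousLinearMap.integral_apply (hH'.integrable_of_ae_mem_compact hK hm)]
  congr 1 with p
  have h1 : HasFDerivAt H (fderiv ℝ H (p, x)) (p, x) :=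
    (hH.differentiable (by simp) _).hasFDerivAt
  have h2 : HasFDerivAt (fun y => H (p, y)) _ x := h1.comp x (hasFDerivAt_prodMk_right p x)
  rw [h2.fderiv]

end ParametricIntegral

section SphereMeasure

/-- Rotation by the angle `θ` in the coordinate plane spanned by the axes `i` and `j`. -/
def planeRot (i j : Fin 3) (θ : ℝ) (y : Fin 3 → ℝ) : Fin 3 → ℝ := fun k =>
  if k = i then Real.cos θ * y i - Real.sin θ * y j
  else if k = j then Real.sin θ * y i + Real.cos θ * y j else y k

theorem sum_sq_planeRot {i j : Fin 3} (hij : i ≠ j) (θ : ℝ) (y : Fin 3 → ℝ) :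
    ∑ k, planeRot i j θ y k ^ 2 = ∑ k, y k ^ 2 := by
  have h := Real.sin_sq_add_cos_sq θ
  fin_cases i <;> fin_cases j <;> simp [planeRot, Fin.sum_univ_three] at hij ⊢ <;> grind

theorem contDiff_planeRot (i j : Fin 3) :
    ContDiff ℝ ∞ fun q : (Fin 3 → ℝ) × ℝ => planeRot i j q.2 q.1 := by
  refine contDiff_pi.2 fun k => ?_
  unfold planeRot
  split_ifs <;> fun_prop

theorem measurable_planeRot (i j : Fin 3) (θ : ℝ) : Measurable (planeRot i j θ) :=
  ((contDiff_planeRot i j).continuous.comp (Continuous.prodMk_left θ)).measurable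

theorem measurePreserving_planeRot {i j : Fin 3} (hij : i ≠ j) (θ : ℝ) :
    MeasurePreserving (planeRot i j θ) := by
  refine ⟨measurable_planeRot i j θ, ?_⟩
  set M : Matrix (Fin 3) (Fin 3) ℝ := Matrix.of fun k l => planeRot i j θ (Pi.single l 1) k
    with hM
  have hdet : M.det = 1 := by
    have h := Real.sin_sq_add_cos_sq θ
    fin_cases i <;> fin_cases j <;>
      simp [hM, planeRot, Matrix.det_fin_three, Pi.single_apply] at hij ⊢ <;> linarith
  have hrot : planeRot i j θ = Matrix.toLin' M := by
    ext y k
    fin_cases i <;> fin_cases j <;> fin_cases k <;>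
      simp [hM, planeRot, Matrix.mulVec, dotProduct, Fin.sum_univ_three, Pi.single_apply] at hij ⊢
      <;> ring
  rw [hrot, Real.map_matrix_volume_pi_eq_smul_volume_pi (by simp [hdet]), hdet]
  simp

/-- The Euclidean unit ball of `Fin 3 → ℝ`. -/
def euclBall : Set (Fin 3 → ℝ) := {y | ∑ k, y k ^ 2 ≤ 1}

/-- The radial projection onto the Euclidean unit sphere of `Fin 3 → ℝ`. -/
def radialProj (y : Fin 3 → ℝ) : Fin 3 → ℝ := (√(∑ k, y k ^ 2))⁻¹ • y

theorem measurable_radialProj : Measurable radialProj := by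
  unfold radialProj
  fun_prop

theorem measurableSet_euclBall : MeasurableSet euclBall :=
  measurableSet_le (by fun_prop) (by fun_prop)

/-- The uniform probability measure on the Euclidean unit sphere of `Fin 3 → ℝ`. -/
def sphereMeasure : Measure (Fin 3 → ℝ) :=
  (ProbabilityTheory.cond volume euclBall).map radialProj

theorem volume_euclBall_ne_zero : (volume : Measure (Fin 3 → ℝ)) euclBall ≠ 0 := by
  refine ((Metric.isOpen_ball.measure_pos volume
    ⟨0, Metric.mem_ball_self (x := (0 : Fin 3 → ℝ)) one_half_pos⟩).trans_le
    (measure_mono fun y hy => ?_)).ne'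
  rw [mem_ball_zero_iff, pi_norm_lt_iff one_half_pos] at hy
  have h : ∀ k, y k ^ 2 ≤ 1 / 4 := fun k => by
    have := abs_lt.1 (hy k)
    nlinarith
  simp only [euclBall, mem_ofPred_eq, Fin.sum_univ_three]
  linarith [h 0, h 1, h 2]

theorem volume_euclBall_ne_top : (volume : Measure (Fin 3 → ℝ)) euclBall ≠ ⊤ := by
  refine ((measure_mono fun y hy => ?_).trans_lt
    (isCompact_closedBall (0 : Fin 3 → ℝ) 1).measure_lt_top).ne
  rw [mem_closedBall_zero_iff, pi_norm_le_iff_of_nonneg zero_le_one]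
  intro k
  have h1 : y k ^ 2 ≤ ∑ k, y k ^ 2 :=
    Finset.single_le_sum (f := fun k => y k ^ 2) (fun k _ => sq_nonneg _) (Finset.mem_univ k)
  exact (sq_le_one_iff_abs_le_one _).1 (h1.trans hy)

instance : IsProbabilityMeasure sphereMeasure :=
  haveI := ProbabilityTheory.cond_isProbabilityMeasure_of_finite volume_euclBall_ne_zero
    volume_euclBall_ne_top
  Measure.isProbabilityMeasure_map measurable_radialProj.aemeasurable

theorem ae_sphereMeasure : ∀ᵐ w ∂sphereMeasure, ∑ k, w k ^ 2 = 1 := by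
  rw [sphereMeasure, ae_map_iff measurable_radialProj.aemeasurable
    (measurableSet_eq_fun (by fun_prop) (by fun_prop))]
  have h : ∀ᵐ y : Fin 3 → ℝ, y ≠ 0 := by simp [ae_iff]
  filter_upwards [ProbabilityTheory.cond_absolutelyContinuous h] with y hy
  have hpos : 0 < ∑ k, y k ^ 2 := by
    obtain ⟨k, hk⟩ := Function.ne_iff.1 hy
    exact Finset.sum_pos' (fun k _ => sq_nonneg _) ⟨k, Finset.mem_univ k, sq_pos_of_ne_zero hk⟩
  simp only [radialProj, Pi.smul_apply, smul_eq_mul, mul_pow, ← Finset.mul_sum, inv_pow,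
    Real.sq_sqrt hpos.le]
  exact inv_mul_cancel₀ hpos.ne'

theorem measurePreserving_planeRot_sphereMeasure {i j : Fin 3} (hij : i ≠ j) (θ : ℝ) :
    MeasurePreserving (planeRot i j θ) sphereMeasure sphereMeasure := by
  refine ⟨measurable_planeRot i j θ, ?_⟩
  have hcomm : planeRot i j θ ∘ radialProj = radialProj ∘ planeRot i j θ := by
    ext y k
    simp only [Function.comp, radialProj, sum_sq_planeRot hij]
    simp only [planeRot, Pi.smul_apply, smul_eq_mul]
    split_ifs <;> ring
  have hpre : planeRot i j θ ⁻¹' euclBall = euclBall := by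
    ext y
    simp [euclBall, sum_sq_planeRot hij]
  have hcond : (ProbabilityTheory.cond volume euclBall).map (planeRot i j θ) =
      ProbabilityTheory.cond volume euclBall := by
    have h := (measurePreserving_planeRot hij θ).restrict_preimage measurableSet_euclBall
    rw [hpre] at h
    rw [ProbabilityTheory.cond, Measure.map_smul, h.map_eq]
  rw [sphereMeasure, Measure.map_map (measurable_planeRot i j θ) measurable_radialProj, hcomm,
    ← Measure.map_map measurable_radialProj (measurable_planeRot i j θ), hcond]

theorem ae_mem_closedBall_sphereMeasure :
    ∀ᵐ w ∂sphereMeasure, w ∈ Metric.closedBall (0 : Fin 3 → ℝ) 1 := by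
  filter_upwards [ae_sphereMeasure] with w hw
  rw [mem_closedBall_zero_iff, pi_norm_le_iff_of_nonneg zero_le_one]
  intro k
  have h1 : w k ^ 2 ≤ ∑ k, w k ^ 2 :=
    Finset.single_le_sum (f := fun k => w k ^ 2) (fun k _ => sq_nonneg _) (Finset.mem_univ k)
  exact (sq_le_one_iff_abs_le_one _).1 (h1.trans hw.le)

/-- Infinitesimal rotations integrate to zero over the sphere. -/
theorem integral_deriv_planeRot {i j : Fin 3} (hij : i ≠ j) {G : (Fin 3 → ℝ) → ℝ}
    (hG : ContDiff ℝ ∞ G) :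
    ∫ w, deriv (fun θ => G (planeRot i j θ w)) 0 ∂sphereMeasure = 0 := by
  have hH : ContDiff ℝ ∞ fun q : (Fin 3 → ℝ) × ℝ => G (planeRot i j q.2 q.1) :=
    hG.comp (contDiff_planeRot i j)
  have h := fderiv_integral_apply_of_ae_mem_compact hH (isCompact_closedBall 0 1)
    ae_mem_closedBall_sphereMeasure 0 1
  have hconst : (fun θ => ∫ w, G (planeRot i j θ w) ∂sphereMeasure) =
      fun _ => ∫ w, G w ∂sphereMeasure := by
    ext θ
    have hmp := measurePreserving_planeRot_sphereMeasure hij θ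
    conv_rhs => rw [← hmp.map_eq]
    rw [integral_map hmp.measurable.aemeasurable hG.continuous.aestronglyMeasurable]
  simp only [hconst] at h
  simpa using h.symm

end SphereMeasure

section PartialDerivatives

variable {f g : (Fin 4 → ℝ) → ℝ}

theorem ContDiff.pd (hf : ContDiff ℝ ∞ f) (μ : Fin 4) : ContDiff ℝ ∞ (pd μ f) :=
  (hf.fderiv_right (by simp)).clm_apply contDiff_const

theorem pd_comm (hf : ContDiff ℝ ∞ f) (μ ν : Fin 4) : pd μ (pd ν f) = pd ν (pd μ f) := by
  ext x
  have hd : DifferentiableAt ℝ (fderiv ℝ f) x :=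
    (hf.fderiv_right (m := ∞) (by simp)).differentiable (by simp) x
  have h : ∀ v w : Fin 4 → ℝ,
      fderiv ℝ (fun y => fderiv ℝ f y v) x w = fderiv ℝ (fderiv ℝ f) x w v := fun v w => by
    rw [fderiv_clm_apply hd (differentiableAt_const v)]
    simp
  have hsymm : IsSymmSndFDerivAt ℝ f x := hf.contDiffAt.isSymmSndFDerivAt
    (by simpa using WithTop.coe_le_coe.2 (le_top : (2 : ℕ∞) ≤ ⊤))
  change fderiv ℝ (fun y => fderiv ℝ f y _) x _ = fderiv ℝ (fun y => fderiv ℝ f y _) x _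
  rw [h, h, hsymm.eq]

theorem pd_add (hf : ContDiff ℝ ∞ f) (hg : ContDiff ℝ ∞ g) (μ : Fin 4) :
    pd μ (fun x => f x + g x) = fun x => pd μ f x + pd μ g x := by
  ext x
  simp [pd, fderiv_fun_add (hf.differentiable (by simp) x) (hg.differentiable (by simp) x)]

theorem pd_sub (hf : ContDiff ℝ ∞ f) (hg : ContDiff ℝ ∞ g) (μ : Fin 4) :
    pd μ (fun x => f x - g x) = fun x => pd μ f x - pd μ g x := by
  ext x
  simp [pd, fderiv_fun_sub (hf.differentiable (by simp) x) (hg.differentiable (by simp) x)]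

theorem pd_neg (f : (Fin 4 → ℝ) → ℝ) (μ : Fin 4) :
    pd μ (fun x => -f x) = fun x => -pd μ f x := by
  ext x
  simp [pd, fderiv_fun_neg]

theorem pd_mul (hf : ContDiff ℝ ∞ f) (hg : ContDiff ℝ ∞ g) (μ : Fin 4) :
    pd μ (fun x => f x * g x) = fun x => f x * pd μ g x + g x * pd μ f x := by
  ext x
  simp [pd, fderiv_fun_mul (hf.differentiable (by simp) x) (hg.differentiable (by simp) x)]

theorem pd_const_mul (hf : ContDiff ℝ ∞ f) (c : ℝ) (μ : Fin 4) :
    pd μ (fun x => c * f x) = fun x => c * pd μ f x := by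
  ext x
  simp [pd, fderiv_const_mul (hf.differentiable (by simp) x)]

theorem pd_const (c : ℝ) (μ : Fin 4) : pd μ (fun _ => c) = fun _ => 0 := by
  ext x
  simp [pd]

theorem pd_sum {ι : Type} {s : Finset ι} {h : ι → (Fin 4 → ℝ) → ℝ}
    (hh : ∀ i ∈ s, ContDiff ℝ ∞ (h i)) (μ : Fin 4) :
    pd μ (fun x => ∑ i ∈ s, h i x) = fun x => ∑ i ∈ s, pd μ (h i) x := by
  ext x
  simp [pd, fderiv_fun_sum fun i hi => (hh i hi).differentiable (by simp) x]

theorem pd_coord (μ ν : Fin 4) :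
    pd μ (fun x => x ν) = fun _ => (Pi.single μ 1 : Fin 4 → ℝ) ν := by
  ext x
  have h : HasFDerivAt (fun x : Fin 4 → ℝ => x ν)
      (ContinuousLinearMap.proj (R := ℝ) (φ := fun _ : Fin 4 => ℝ) ν) x :=
    hasFDerivAt_apply ν x
  simp [pd, h.fderiv]

theorem hasDerivAt_comp_curve (hf : ContDiff ℝ ∞ f) {c : ℝ → Fin 4 → ℝ} {c' : Fin 4 → ℝ}
    {s : ℝ} (hc : ∀ ν, HasDerivAt (fun r => c r ν) (c' ν) s) :
    HasDerivAt (fun r => f (c r)) (∑ ν, pd ν f (c s) * c' ν) s := by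
  have h1 : HasDerivAt c c' s := hasDerivAt_pi.2 hc
  have h2 := (hf.differentiable (by simp) (c s)).hasFDerivAt.comp_hasDerivAt s h1
  have h3 : fderiv ℝ f (c s) c' = ∑ ν, pd ν f (c s) * c' ν := by
    conv_lhs => rw [← Finset.univ_sum_single c', map_sum]
    refine Finset.sum_congr rfl fun ν _ => ?_
    rw [pd, mul_comm, ← smul_eq_mul, ← map_smul, ← Pi.single_smul, smul_eq_mul, mul_one]
  rwa [h3] at h2

theorem hasDerivAt_add_single (hf : ContDiff ℝ ∞ f) (μ : Fin 4) (x : Fin 4 → ℝ) :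
    HasDerivAt (fun r : ℝ => f (x + r • Pi.single μ 1)) (pd μ f x) 0 := by
  have h : HasFDerivAt f (fderiv ℝ f x) (x + (0 : ℝ) • Pi.single μ 1) := by
    simpa using (hf.differentiable (by simp) x).hasFDerivAt
  refine h.comp_hasDerivAt 0 ?_
  simpa using ((hasDerivAt_id (0 : ℝ)).smul_const (Pi.single μ (1 : ℝ) : Fin 4 → ℝ)).const_add x

theorem pd_comp_add_smul (hf : ContDiff ℝ ∞ f) (w : Fin 4 → ℝ) (μ : Fin 4) :
    pd μ (fun x => f (x + x 0 • w)) = fun x => pd μ f (x + x 0 • w) +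
      (Pi.single μ 1 : Fin 4 → ℝ) 0 * ∑ ν, w ν * pd ν f (x + x 0 • w) := by
  ext x
  have hsm : ContDiff ℝ ∞ fun x : Fin 4 → ℝ => f (x + x 0 • w) := hf.comp (by fun_prop)
  refine (hasDerivAt_add_single hsm μ x).unique ?_
  have h := hasDerivAt_comp_curve hf (s := 0)
    (c := fun r => (x + r • (Pi.single μ 1 : Fin 4 → ℝ)) +
      (x + r • (Pi.single μ 1 : Fin 4 → ℝ)) 0 • w)
    (c' := fun ν => (Pi.single μ 1 : Fin 4 → ℝ) ν + (Pi.single μ 1 : Fin 4 → ℝ) 0 * w ν)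
    (fun ν => by
      simp only [Pi.add_apply, Pi.smul_apply, smul_eq_mul]
      have h1 : ∀ ν, HasDerivAt (fun r : ℝ => x ν + r * (Pi.single μ 1 : Fin 4 → ℝ) ν)
        ((Pi.single μ 1 : Fin 4 → ℝ) ν) 0 := fun ν => by
          simpa using ((hasDerivAt_id (0 : ℝ)).mul_const
            ((Pi.single μ 1 : Fin 4 → ℝ) ν)).const_add (x ν)
      exact (h1 ν).add ((h1 0).mul_const (w ν)))
  refine h.congr_deriv ?_
  simp only [zero_smul, add_zero, mul_add, Finset.sum_add_distrib, Finset.mul_sum]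
  congr 1
  · simp [Pi.single_apply]
  · exact Finset.sum_congr rfl fun ν _ => by ring

/-- The wave operator. -/
def dAlembert (f : (Fin 4 → ℝ) → ℝ) (x : Fin 4 → ℝ) : ℝ :=
  ∑ μ, η μ μ * pd μ (pd μ f) x

theorem dAlembert_eq (f : (Fin 4 → ℝ) → ℝ) (x : Fin 4 → ℝ) :
    dAlembert f x = pd 0 (pd 0 f) x - pd 1 (pd 1 f) x - pd 2 (pd 2 f) x - pd 3 (pd 3 f) x := by
  simp [dAlembert, η, Fin.sum_univ_four]
  ring

theorem ContDiff.dAlembert (hf : ContDiff ℝ ∞ f) : ContDiff ℝ ∞ (dAlembert f) := by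
  unfold _root_.dAlembert
  exact ContDiff.sum fun μ _ => contDiff_const.mul ((hf.pd μ).pd μ)

theorem continuous_deriv_snd {P : Type} [NormedAddCommGroup P] [NormedSpace ℝ P]
    {H : P × ℝ → ℝ} (hH : ContDiff ℝ ∞ H) :
    Continuous fun q : P × ℝ => deriv (fun s => H (q.1, s)) q.2 := by
  have h : (fun q : P × ℝ => deriv (fun s => H (q.1, s)) q.2) =
      fun q => fderiv ℝ H q (0, 1) := by
    ext q
    have h1 : HasFDerivAt H (fderiv ℝ H q) (q.1, q.2) :=
      (hH.differentiable (by simp) _).hasFDerivAt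
    have h2 : HasDerivAt (fun s => H (q.1, s)) _ q.2 :=
      h1.comp_hasDerivAt q.2 ((hasDerivAt_const q.2 q.1).prodMk (hasDerivAt_id q.2))
    exact h2.deriv
  rw [h]
  exact (hH.continuous_fderiv (by simp)).clm_apply continuous_const

end PartialDerivatives

section RetardedPotential

/-- The direction in which the backward light cone through a point is traversed: the point at
fraction `p.1` of the cone over the sphere point `p.2`, per unit of time. -/
def coneShift (p : ℝ × (Fin 3 → ℝ)) : Fin 4 → ℝ :=
  ![-p.1, p.1 * p.2 0, p.1 * p.2 1, p.1 * p.2 2]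

/-- Lebesgue measure on the unit interval times the uniform measure on the sphere. -/
def coneMeasure : Measure (ℝ × (Fin 3 → ℝ)) :=
  (volume.restrict (Icc 0 1)).prod sphereMeasure

instance : IsFiniteMeasure coneMeasure := by
  unfold coneMeasure
  infer_instance

/-- The Kirchhoff retarded potential with vanishing Cauchy data at time `0`. -/
def retarded (f : (Fin 4 → ℝ) → ℝ) (x : Fin 4 → ℝ) : ℝ :=
  ∫ p, x 0 ^ 2 * (p.1 * f (x + x 0 • coneShift p)) ∂coneMeasure

variable {f : (Fin 4 → ℝ) → ℝ}

theorem ae_coneMeasure : ∀ᵐ p ∂coneMeasure, ∑ k, p.2 k ^ 2 = 1 :=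
  Measure.quasiMeasurePreserving_snd.ae ae_sphereMeasure

theorem ae_mem_coneMeasure :
    ∀ᵐ p ∂coneMeasure, p ∈ Icc (0 : ℝ) 1 ×ˢ Metric.closedBall (0 : Fin 3 → ℝ) 1 := by
  filter_upwards [Measure.quasiMeasurePreserving_fst.ae (ae_restrict_mem measurableSet_Icc),
    Measure.quasiMeasurePreserving_snd.ae ae_mem_closedBall_sphereMeasure] with p h1 h2
  exact ⟨h1, h2⟩

theorem isCompact_cone :
    IsCompact (Icc (0 : ℝ) 1 ×ˢ Metric.closedBall (0 : Fin 3 → ℝ) 1) :=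
  isCompact_Icc.prod (isCompact_closedBall 0 1)

theorem Continuous.integrable_coneMeasure {g : ℝ × (Fin 3 → ℝ) → ℝ} (hg : Continuous g) :
    Integrable g coneMeasure :=
  hg.integrable_of_ae_mem_compact isCompact_cone ae_mem_coneMeasure

theorem contDiff_coneShift : ContDiff ℝ ∞ coneShift := by
  refine contDiff_pi.2 fun ν => ?_
  fin_cases ν <;> simp [coneShift] <;> fun_prop

theorem contDiff_comp_coneShift (hf : ContDiff ℝ ∞ f) :
    ContDiff ℝ ∞ fun q : (ℝ × (Fin 3 → ℝ)) × (Fin 4 → ℝ) =>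
      f (q.2 + q.2 0 • coneShift q.1) := by
  have := contDiff_coneShift
  exact hf.comp (by fun_prop)

theorem contDiff_retarded_integrand (hf : ContDiff ℝ ∞ f) :
    ContDiff ℝ ∞ fun q : (ℝ × (Fin 3 → ℝ)) × (Fin 4 → ℝ) =>
      q.2 0 ^ 2 * (q.1.1 * f (q.2 + q.2 0 • coneShift q.1)) := by
  have h := contDiff_comp_coneShift hf
  exact ContDiff.mul (by fun_prop) (ContDiff.mul (by fun_prop) h)

theorem contDiff_retarded (hf : ContDiff ℝ ∞ f) : ContDiff ℝ ∞ (retarded f) :=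
  contDiff_integral_of_ae_mem_compact (contDiff_retarded_integrand hf) isCompact_cone
    ae_mem_coneMeasure

theorem contDiff_pd_snd {P : Type} [NormedAddCommGroup P] [NormedSpace ℝ P]
    {H : P × (Fin 4 → ℝ) → ℝ} (hH : ContDiff ℝ ∞ H) (μ : Fin 4) :
    ContDiff ℝ ∞ fun q : P × (Fin 4 → ℝ) => pd μ (fun x => H (q.1, x)) q.2 := by
  have h : (fun q : P × (Fin 4 → ℝ) => pd μ (fun x => H (q.1, x)) q.2) =
      fun q => fderiv ℝ H q (0, Pi.single μ 1) := by
    ext q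
    have h1 : HasFDerivAt H (fderiv ℝ H q) (q.1, q.2) :=
      (hH.differentiable (by simp) _).hasFDerivAt
    have h2 : HasFDerivAt (fun x => H (q.1, x)) _ q.2 :=
      h1.comp q.2 (hasFDerivAt_prodMk_right q.1 q.2)
    simp [pd, h2.fderiv]
  rw [h]
  exact (hH.fderiv_right (by simp)).clm_apply contDiff_const

theorem pd_integral_coneMeasure {H : (ℝ × (Fin 3 → ℝ)) × (Fin 4 → ℝ) → ℝ}
    (hH : ContDiff ℝ ∞ H) (μ : Fin 4) :
    pd μ (fun x => ∫ p, H (p, x) ∂coneMeasure) =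
      fun x => ∫ p, pd μ (fun y => H (p, y)) x ∂coneMeasure := by
  ext x
  exact fderiv_integral_apply_of_ae_mem_compact hH isCompact_cone ae_mem_coneMeasure x _

theorem dAlembert_integral_coneMeasure {H : (ℝ × (Fin 3 → ℝ)) × (Fin 4 → ℝ) → ℝ}
    (hH : ContDiff ℝ ∞ H) (x : Fin 4 → ℝ) :
    dAlembert (fun x => ∫ p, H (p, x) ∂coneMeasure) x =
      ∫ p, dAlembert (fun y => H (p, y)) x ∂coneMeasure := by
  have h2 : ∀ μ, ContDiff ℝ ∞ fun q : (ℝ × (Fin 3 → ℝ)) × (Fin 4 → ℝ) =>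
      pd μ (pd μ fun x => H (q.1, x)) q.2 := fun μ => contDiff_pd_snd (contDiff_pd_snd hH μ) μ
  have hint : ∀ μ ∈ Finset.univ, Integrable
      (fun p => η μ μ * pd μ (pd μ fun y => H (p, y)) x) coneMeasure := fun μ _ =>
    Continuous.integrable_coneMeasure
      (continuous_const.mul ((h2 μ).continuous.comp (Continuous.prodMk_left x)))
  refine Eq.trans (Finset.sum_congr rfl fun μ _ => ?_) (integral_finsetSum _ hint).symm
  rw [pd_integral_coneMeasure hH, pd_integral_coneMeasure (contDiff_pd_snd hH μ),
    integral_const_mul]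

theorem pd_succ_retarded (hf : ContDiff ℝ ∞ f) (i : Fin 3) :
    pd i.succ (retarded f) = retarded (pd i.succ f) := by
  unfold retarded
  rw [pd_integral_coneMeasure (contDiff_retarded_integrand hf)]
  ext x
  congr 1 with p
  have ha : ContDiff ℝ ∞ fun x : Fin 4 → ℝ => f (x + x 0 • coneShift p) :=
    hf.comp (by fun_prop)
  have hsq : ContDiff ℝ ∞ fun x : Fin 4 → ℝ => x 0 * x 0 := by fun_prop
  simp only [pow_two]
  rw [pd_mul hsq (contDiff_const.mul ha), pd_const_mul ha, pd_comp_add_smul hf,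
    pd_mul (by fun_prop) (by fun_prop), pd_coord]
  simp

theorem retarded_sum {ι : Type} {s : Finset ι} {h : ι → (Fin 4 → ℝ) → ℝ}
    (hh : ∀ i ∈ s, ContDiff ℝ ∞ (h i)) (x : Fin 4 → ℝ) :
    ∑ i ∈ s, retarded (h i) x = retarded (fun y => ∑ i ∈ s, h i y) x := by
  simp only [retarded, Finset.mul_sum]
  exact (integral_finsetSum _ fun i hi => Continuous.integrable_coneMeasure
    ((contDiff_retarded_integrand (hh i hi)).continuous.comp (Continuous.prodMk_left x))).symm

/-- A primitive, along the radial direction of the light cone, of the radial part of the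
wave operator applied to the integrand of the retarded potential. -/
def conePrimitive (f : (Fin 4 → ℝ) → ℝ) (x : Fin 4 → ℝ) (p : ℝ × (Fin 3 → ℝ)) : ℝ :=
  (p.1 ^ 2 - 1) * f (x + x 0 • coneShift p)
    - p.1 * (1 - p.1) ^ 2 * x 0 * pd 0 f (x + x 0 • coneShift p)
    - p.1 * (1 - p.1 ^ 2) * x 0 * ∑ i : Fin 3, p.2 i * pd i.succ f (x + x 0 • coneShift p)

/-- The derivative of `f` along an infinitesimal rotation of the light cone. -/
def coneRotDeriv (f : (Fin 4 → ℝ) → ℝ) (x : Fin 4 → ℝ) (i j : Fin 3)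
    (p : ℝ × (Fin 3 → ℝ)) : ℝ :=
  x 0 * (p.2 i * pd j.succ f (x + x 0 • coneShift p)
    - p.2 j * pd i.succ f (x + x 0 • coneShift p))

theorem contDiff_conePrimitive (hf : ContDiff ℝ ∞ f) (x : Fin 4 → ℝ) :
    ContDiff ℝ ∞ (conePrimitive f x) := by
  have h : ∀ {g : (Fin 4 → ℝ) → ℝ}, ContDiff ℝ ∞ g →
      ContDiff ℝ ∞ fun p => g (x + x 0 • coneShift p) := fun hg =>
    hg.comp (contDiff_const.add (contDiff_coneShift.const_smul (x 0)))
  have h0 := h hf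
  have h1 := fun μ => h (hf.pd μ)
  exact ((ContDiff.mul (by fun_prop) h0).sub (ContDiff.mul (by fun_prop) (h1 0))).sub
    (ContDiff.mul (by fun_prop) (ContDiff.sum fun i _ => ContDiff.mul (by fun_prop) (h1 i.succ)))

theorem contDiff_coneRotDeriv (hf : ContDiff ℝ ∞ f) (x : Fin 4 → ℝ) (i j : Fin 3) :
    ContDiff ℝ ∞ (coneRotDeriv f x i j) := by
  have h1 : ∀ μ, ContDiff ℝ ∞ fun p => pd μ f (x + x 0 • coneShift p) := fun μ =>
    (hf.pd μ).comp (contDiff_const.add (contDiff_coneShift.const_smul (x 0)))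
  exact contDiff_const.mul ((ContDiff.mul (by fun_prop) (h1 j.succ)).sub
    (ContDiff.mul (by fun_prop) (h1 i.succ)))

theorem hasDerivAt_comp_coneShift_radial (hf : ContDiff ℝ ∞ f) (x : Fin 4 → ℝ) (l : ℝ)
    (w : Fin 3 → ℝ) :
    HasDerivAt (fun r => f (x + x 0 • coneShift (r, w)))
      (x 0 * (-pd 0 f (x + x 0 • coneShift (l, w))
        + ∑ i : Fin 3, w i * pd i.succ f (x + x 0 • coneShift (l, w)))) l := by
  have h := hasDerivAt_comp_curve hf (s := l) (c := fun r => x + x 0 • coneShift (r, w))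
    (c' := fun ν => x 0 * (![-1, w 0, w 1, w 2] : Fin 4 → ℝ) ν) (fun ν => by
      simp only [Pi.add_apply, Pi.smul_apply, smul_eq_mul]
      refine HasDerivAt.const_add _ (HasDerivAt.const_mul _ ?_)
      have hid := hasDerivAt_id l
      fin_cases ν
      · exact hid.neg
      all_goals simpa [coneShift] using hid.mul_const _)
  refine h.congr_deriv ?_
  simp [Fin.sum_univ_four, Fin.sum_univ_three]
  ring

theorem hasDerivAt_planeRot {i j : Fin 3} (hij : i ≠ j) (w : Fin 3 → ℝ) (k : Fin 3) :
    HasDerivAt (fun θ => planeRot i j θ w k)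
      (w i * (Pi.single j 1 : Fin 3 → ℝ) k - w j * (Pi.single i 1 : Fin 3 → ℝ) k) 0 := by
  have hc := Real.hasDerivAt_cos 0
  have hs := Real.hasDerivAt_sin 0
  simp only [Real.sin_zero, Real.cos_zero, neg_zero] at hc hs
  by_cases hki : k = i
  · subst hki
    simpa [planeRot, Pi.single_apply, hij] using
      (hc.mul_const (w k)).fun_sub (hs.mul_const (w j))
  · by_cases hkj : k = j
    · subst hkj
      simpa [planeRot, Pi.single_apply, hki] using
        (hs.mul_const (w i)).fun_add (hc.mul_const (w k))
    · simpa [planeRot, Pi.single_apply, hki, hkj] using hasDerivAt_const (0 : ℝ) (w k)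

theorem planeRot_zero {i j : Fin 3} (w : Fin 3 → ℝ) : planeRot i j 0 w = w := by
  ext k
  simp only [planeRot, Real.cos_zero, Real.sin_zero]
  split_ifs with h1 h2 <;> simp [*]

theorem hasDerivAt_comp_coneShift_rot (hf : ContDiff ℝ ∞ f) (x : Fin 4 → ℝ) (l : ℝ)
    (w : Fin 3 → ℝ) {i j : Fin 3} (hij : i ≠ j) :
    HasDerivAt (fun θ => f (x + x 0 • coneShift (l, planeRot i j θ w)))
      (x 0 * l * (w i * pd j.succ f (x + x 0 • coneShift (l, w))
        - w j * pd i.succ f (x + x 0 • coneShift (l, w)))) 0 := by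
  have hr := hasDerivAt_planeRot hij w
  have h := hasDerivAt_comp_curve hf (s := 0)
    (c := fun θ => x + x 0 • coneShift (l, planeRot i j θ w))
    (c' := fun ν => x 0 * (Fin.cons 0 fun k => l * (w i * (Pi.single j 1 : Fin 3 → ℝ) k -
      w j * (Pi.single i 1 : Fin 3 → ℝ) k) : Fin 4 → ℝ) ν) (fun ν => by
      simp only [Pi.add_apply, Pi.smul_apply, smul_eq_mul]
      refine HasDerivAt.const_add _ (HasDerivAt.const_mul _ ?_)
      fin_cases ν
      · simpa [coneShift] using hasDerivAt_const (0 : ℝ) (-l)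
      · exact (hr 0).const_mul l
      · exact (hr 1).const_mul l
      · exact (hr 2).const_mul l)
  refine h.congr_deriv ?_
  simp only [planeRot_zero]
  rw [Fin.sum_univ_succ]
  simp only [Fin.cons_zero, Fin.cons_succ, mul_zero, zero_add]
  fin_cases i <;> fin_cases j <;> simp [Fin.sum_univ_three] at hij ⊢ <;> ring

theorem deriv_conePrimitive (hf : ContDiff ℝ ∞ f) (x : Fin 4 → ℝ) (l : ℝ) (w : Fin 3 → ℝ)
    {D : ((Fin 4 → ℝ) → ℝ) → ℝ} (hD : D = fun g =>
      x 0 * (-pd 0 g (x + x 0 • coneShift (l, w))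
        + ∑ i : Fin 3, w i * pd i.succ g (x + x 0 • coneShift (l, w)))) :
    deriv (fun r => conePrimitive f x (r, w)) l =
      2 * l * f (x + x 0 • coneShift (l, w)) + (l ^ 2 - 1) * D f
      - ((1 - l) ^ 2 - 2 * l * (1 - l)) * x 0 * pd 0 f (x + x 0 • coneShift (l, w))
      - l * (1 - l) ^ 2 * x 0 * D (pd 0 f)
      - (1 - 3 * l ^ 2) * x 0 * ∑ i : Fin 3, w i * pd i.succ f (x + x 0 • coneShift (l, w))
      - l * (1 - l ^ 2) * x 0 * ∑ i : Fin 3, w i * D (pd i.succ f) := by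
  have hr : ∀ {g : (Fin 4 → ℝ) → ℝ}, ContDiff ℝ ∞ g →
      HasDerivAt (fun r => g (x + x 0 • coneShift (r, w))) (D g) l := fun hg => by
    rw [hD]
    exact hasDerivAt_comp_coneShift_radial hg x l w
  have hid := hasDerivAt_id' l
  have h1 := ((hid.pow 2).sub_const 1).mul (hr hf)
  have h2 := ((hid.mul ((hid.const_sub 1).pow 2)).mul_const (x 0)).mul (hr (hf.pd 0))
  have h3 := ((hid.mul ((hid.pow 2).const_sub 1)).mul_const (x 0)).mul
    (HasDerivAt.fun_sum (u := Finset.univ) fun i _ => (hr (hf.pd i.succ)).const_mul (w i))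
  refine ((h1.sub h2).sub h3).deriv.trans ?_
  simp
  ring

theorem deriv_coneRotDeriv (hf : ContDiff ℝ ∞ f) (x : Fin 4 → ℝ) (l : ℝ) (w : Fin 3 → ℝ)
    {i j : Fin 3} (hij : i ≠ j) {R : ((Fin 4 → ℝ) → ℝ) → ℝ} (hR : R = fun g =>
      x 0 * l * (w i * pd j.succ g (x + x 0 • coneShift (l, w))
        - w j * pd i.succ g (x + x 0 • coneShift (l, w)))) :
    deriv (fun θ => coneRotDeriv f x i j (l, planeRot i j θ w)) 0 =
      x 0 * (w i * R (pd j.succ f) - w j * R (pd i.succ f)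
        - w j * pd j.succ f (x + x 0 • coneShift (l, w))
        - w i * pd i.succ f (x + x 0 • coneShift (l, w))) := by
  have hr : ∀ {g : (Fin 4 → ℝ) → ℝ}, ContDiff ℝ ∞ g →
      HasDerivAt (fun θ => g (x + x 0 • coneShift (l, planeRot i j θ w))) (R g) 0 := fun hg => by
    rw [hR]
    exact hasDerivAt_comp_coneShift_rot hg x l w hij
  have h := ((((hasDerivAt_planeRot hij w i).mul (hr (hf.pd j.succ))).sub
    ((hasDerivAt_planeRot hij w j).mul (hr (hf.pd i.succ)))).const_mul (x 0))
  refine h.deriv.trans ?_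
  simp only [planeRot_zero, Pi.single_eq_same, Pi.single_eq_of_ne hij, Pi.single_eq_of_ne hij.symm]
  ring

theorem dAlembert_sq_mul {a : (Fin 4 → ℝ) → ℝ} (ha : ContDiff ℝ ∞ a) (l : ℝ)
    (x : Fin 4 → ℝ) :
    dAlembert (fun x => x 0 ^ 2 * (l * a x)) x =
      l * (x 0 ^ 2 * dAlembert a x + 4 * x 0 * pd 0 a x + 2 * a x) := by
  have hx : ContDiff ℝ ∞ fun x : Fin 4 → ℝ => x 0 := by fun_prop
  have h1 : ∀ μ, pd μ (fun x => x 0 ^ 2 * (l * a x)) = fun x =>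
      x 0 * (x 0 * (l * pd μ a x)) + x 0 * ((2 * l * (Pi.single μ 1 : Fin 4 → ℝ) 0) * a x) := by
    intro μ
    simp only [pow_two]
    rw [pd_mul (hx.mul hx) (contDiff_const.mul ha), pd_const_mul ha, pd_mul hx hx, pd_coord]
    ext x
    ring
  have h2 : ∀ μ, pd μ (pd μ (fun x => x 0 ^ 2 * (l * a x))) = fun x =>
      l * (x 0 ^ 2 * pd μ (pd μ a) x + 4 * x 0 * (Pi.single μ 1 : Fin 4 → ℝ) 0 * pd μ a x
        + 2 * (Pi.single μ 1 : Fin 4 → ℝ) 0 ^ 2 * a x) := by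
    intro μ
    have hp := contDiff_const (c := l) |>.mul (ha.pd μ)
    rw [h1, pd_add (hx.mul (hx.mul hp)) (hx.mul (contDiff_const.mul ha)), pd_mul hx (hx.mul hp),
      pd_mul hx hp, pd_mul hx (contDiff_const.mul ha), pd_const_mul ha, pd_const_mul (ha.pd μ),
      pd_coord]
    ext x
    ring
  rw [dAlembert_eq, dAlembert_eq, h2, h2, h2, h2]
  simp
  ring

theorem dAlembert_retarded_integrand (hf : ContDiff ℝ ∞ f) (x : Fin 4 → ℝ) (l : ℝ)
    {w : Fin 3 → ℝ} (hw : ∑ k, w k ^ 2 = 1) :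
    dAlembert (fun x => x 0 ^ 2 * (l * f (x + x 0 • coneShift (l, w)))) x =
      deriv (fun r => conePrimitive f x (r, w)) l
        - deriv (fun θ => coneRotDeriv f x 0 1 (l, planeRot 0 1 θ w)) 0
        - deriv (fun θ => coneRotDeriv f x 0 2 (l, planeRot 0 2 θ w)) 0
        - deriv (fun θ => coneRotDeriv f x 1 2 (l, planeRot 1 2 θ w)) 0 := by
  have hL : ContDiff ℝ ∞ fun x : Fin 4 → ℝ => x + x 0 • coneShift (l, w) := by fun_prop
  have hc : ∀ ν, ContDiff ℝ ∞ fun x : Fin 4 → ℝ => pd ν f (x + x 0 • coneShift (l, w)) :=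
    fun ν => (hf.pd ν).comp hL
  have h0 : pd 0 (pd 0 fun x => f (x + x 0 • coneShift (l, w))) x =
      pd 0 (pd 0 f) (x + x 0 • coneShift (l, w))
      + ∑ ν, coneShift (l, w) ν * pd ν (pd 0 f) (x + x 0 • coneShift (l, w))
      + ∑ ν, coneShift (l, w) ν * (pd 0 (pd ν f) (x + x 0 • coneShift (l, w))
        + ∑ μ, coneShift (l, w) μ * pd μ (pd ν f) (x + x 0 • coneShift (l, w))) := by
    simp only [pd_comp_add_smul hf, Pi.single_eq_same, one_mul]
    rw [pd_add (hc 0) (ContDiff.sum fun ν _ => contDiff_const.mul (hc ν)),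
      pd_sum fun ν _ => contDiff_const.mul (hc ν)]
    simp only [pd_const_mul (hc _), pd_comp_add_smul (hf.pd _), Pi.single_eq_same, one_mul]
  have hi : ∀ i : Fin 3, pd i.succ (pd i.succ fun x => f (x + x 0 • coneShift (l, w))) x =
      pd i.succ (pd i.succ f) (x + x 0 • coneShift (l, w)) := fun i => by
    simp [pd_comp_add_smul hf, pd_comp_add_smul (hf.pd _)]
  have h1 := hi 0
  have h2 := hi 1
  have h3 := hi 2
  have ha : ContDiff ℝ ∞ fun x : Fin 4 → ℝ => f (x + x 0 • coneShift (l, w)) := hf.comp hL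
  rw [dAlembert_sq_mul ha, dAlembert_eq, deriv_conePrimitive hf x l w rfl,
    deriv_coneRotDeriv hf x l w (by decide) rfl, deriv_coneRotDeriv hf x l w (by decide) rfl,
    deriv_coneRotDeriv hf x l w (by decide) rfl]
  simp only [Fin.succ_zero_eq_one, Fin.succ_one_eq_two, Fin.reduceSucc] at h1 h2 h3
  rw [h0, h1, h2, h3, pd_comp_add_smul hf]
  have hs0 : coneShift (l, w) 0 = -l := rfl
  have hs1 : coneShift (l, w) 1 = l * w 0 := rfl
  have hs2 : coneShift (l, w) 2 = l * w 1 := rfl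
  have hs3 : coneShift (l, w) 3 = l * w 2 := rfl
  simp only [Fin.sum_univ_four, Fin.sum_univ_three, Fin.succ_zero_eq_one, Fin.succ_one_eq_two,
    Fin.reduceSucc, hs0, hs1, hs2, hs3, Pi.single_eq_same, pd_comm hf 1 0, pd_comm hf 2 0,
    pd_comm hf 3 0, pd_comm hf 2 1, pd_comm hf 3 1, pd_comm hf 3 2] at hw ⊢
  generalize x + x 0 • coneShift (l, w) = y
  linear_combination (l * x 0 ^ 2 * (pd 1 (pd 1 f) y + pd 2 (pd 2 f) y + pd 3 (pd 3 f) y)) * hw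

theorem integral_deriv_planeRot_coneMeasure {G : ℝ × (Fin 3 → ℝ) → ℝ} (hG : ContDiff ℝ ∞ G)
    {i j : Fin 3} (hij : i ≠ j) :
    Integrable (fun p => deriv (fun θ => G (p.1, planeRot i j θ p.2)) 0) coneMeasure ∧
      ∫ p, deriv (fun θ => G (p.1, planeRot i j θ p.2)) 0 ∂coneMeasure = 0 := by
  have hR := contDiff_planeRot i j
  have hH : ContDiff ℝ ∞ fun q : (ℝ × (Fin 3 → ℝ)) × ℝ =>
      G (q.1.1, planeRot i j q.2 q.1.2) :=
    hG.comp (ContDiff.prodMk (by fun_prop) (hR.comp (f := fun q :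
        (ℝ × (Fin 3 → ℝ)) × ℝ => (q.1.2, q.2)) (by fun_prop)))
  have hint : Integrable (fun p => deriv (fun θ => G (p.1, planeRot i j θ p.2)) 0)
      coneMeasure :=
    Continuous.integrable_coneMeasure
      ((continuous_deriv_snd hH).comp (f := fun p => (p, 0)) (by fun_prop))
  refine ⟨hint, (integral_prod _ hint).trans ?_⟩
  have h0 : ∀ l, ∫ w, deriv (fun θ => G (l, planeRot i j θ w)) 0 ∂sphereMeasure = 0 := fun l =>
    integral_deriv_planeRot hij (G := fun w => G (l, w)) (by fun_prop)
  simp [h0]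

theorem integral_deriv_radial_coneMeasure {G : ℝ × (Fin 3 → ℝ) → ℝ} (hG : ContDiff ℝ ∞ G) :
    Integrable (fun p => deriv (fun r => G (r, p.2)) p.1) coneMeasure ∧
      ∫ p, deriv (fun r => G (r, p.2)) p.1 ∂coneMeasure =
        ∫ w, (G (1, w) - G (0, w)) ∂sphereMeasure := by
  have hcont := continuous_deriv_snd (H := fun q : (Fin 3 → ℝ) × ℝ => G (q.2, q.1))
    (by fun_prop)
  have hint : Integrable (fun p => deriv (fun r => G (r, p.2)) p.1) coneMeasure :=
    Continuous.integrable_coneMeasure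
      (hcont.comp (f := fun p : ℝ × (Fin 3 → ℝ) => (p.2, p.1)) (by fun_prop))
  refine ⟨hint, (integral_prod_symm _ hint).trans (integral_congr_ae (.of_forall fun w => ?_))⟩
  have hGw : ContDiff ℝ ∞ fun r => G (r, w) := by fun_prop
  dsimp only
  rw [integral_Icc_eq_integral_Ioc, ← intervalIntegral.integral_of_le zero_le_one,
    intervalIntegral.integral_deriv_eq_sub (fun r _ => hGw.differentiable (by simp) r)
      ((hcont.comp (f := fun r : ℝ => (w, r)) (by fun_prop)).intervalIntegrable 0 1)]

theorem dAlembert_retarded (hf : ContDiff ℝ ∞ f) (x : Fin 4 → ℝ) :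
    dAlembert (retarded f) x = f x := by
  unfold retarded
  rw [dAlembert_integral_coneMeasure (contDiff_retarded_integrand hf)]
  have hae : ∀ᵐ p ∂coneMeasure,
      dAlembert (fun x => x 0 ^ 2 * (p.1 * f (x + x 0 • coneShift p))) x = _ :=
    ae_coneMeasure.mono fun p hp => dAlembert_retarded_integrand hf x p.1 hp
  have hrot := contDiff_coneRotDeriv hf x
  obtain ⟨i0, e0⟩ := integral_deriv_radial_coneMeasure (contDiff_conePrimitive hf x)
  obtain ⟨i1, e1⟩ := integral_deriv_planeRot_coneMeasure (hrot 0 1) (by decide : (0 : Fin 3) ≠ 1)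
  obtain ⟨i2, e2⟩ := integral_deriv_planeRot_coneMeasure (hrot 0 2) (by decide : (0 : Fin 3) ≠ 2)
  obtain ⟨i3, e3⟩ := integral_deriv_planeRot_coneMeasure (hrot 1 2) (by decide : (1 : Fin 3) ≠ 2)
  have i01 := i0.sub i1
  have i012 := i01.sub i2
  refine (integral_congr_ae hae).trans ((integral_sub i012 i3).trans ?_)
  rw [e3, integral_sub' i01 i2, integral_sub' i0 i1, e0, e1, e2]
  have hz : ∀ w, coneShift (0, w) = 0 := fun w => by
    ext ν
    fin_cases ν <;> simp [coneShift]
  simp [conePrimitive, hz]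

end RetardedPotential

/-- The primitive of `f` in the `μ`-th coordinate that vanishes at the origin of that axis. -/
def axisPrimitive (μ : Fin 4) (f : (Fin 4 → ℝ) → ℝ) (x : Fin 4 → ℝ) : ℝ :=
  ∫ s in Icc (0 : ℝ) 1, x μ * f (x + ((s - 1) * x μ) • Pi.single μ 1)

section AxisPrimitive

variable {f : (Fin 4 → ℝ) → ℝ}

theorem contDiff_axisPrimitive_integrand (hf : ContDiff ℝ ∞ f) (μ : Fin 4) :
    ContDiff ℝ ∞ fun q : ℝ × (Fin 4 → ℝ) =>
      q.2 μ * f (q.2 + ((q.1 - 1) * q.2 μ) • Pi.single μ 1) :=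
  ContDiff.mul (by fun_prop) (hf.comp (by fun_prop))

theorem contDiff_axisPrimitive (hf : ContDiff ℝ ∞ f) (μ : Fin 4) :
    ContDiff ℝ ∞ (axisPrimitive μ f) :=
  contDiff_integral_of_ae_mem_compact (contDiff_axisPrimitive_integrand hf μ)
    (isCompact_Icc (a := (0 : ℝ)) (b := 1)) (ae_restrict_mem measurableSet_Icc)

theorem pd_axisPrimitive (hf : ContDiff ℝ ∞ f) (μ : Fin 4) : pd μ (axisPrimitive μ f) = f := by
  ext x
  refine (fderiv_integral_apply_of_ae_mem_compact (contDiff_axisPrimitive_integrand hf μ)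
    (isCompact_Icc (a := (0 : ℝ)) (b := 1)) (ae_restrict_mem measurableSet_Icc) x _).trans ?_
  have hs : ContDiff ℝ ∞ fun s : ℝ => s * f (x + ((s - 1) * x μ) • Pi.single μ 1) :=
    ContDiff.mul (by fun_prop) (hf.comp (by fun_prop))
  have h : ∀ s : ℝ, fderiv ℝ (fun y : Fin 4 → ℝ =>
      y μ * f (y + ((s - 1) * y μ) • Pi.single μ 1)) x (Pi.single μ 1) =
      deriv (fun s : ℝ => s * f (x + ((s - 1) * x μ) • Pi.single μ 1)) s := fun s => by
    have hline : HasDerivAt (fun r : ℝ => f (x + r • Pi.single μ 1))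
        (pd μ f (x + ((s - 1) * x μ) • Pi.single μ 1)) ((s - 1) * x μ) := by
      refine (hf.differentiable (by simp) _).hasFDerivAt.comp_hasDerivAt _ ?_
      simpa using ((hasDerivAt_id ((s - 1) * x μ)).smul_const
        (Pi.single μ (1 : ℝ) : Fin 4 → ℝ)).const_add x
    have h1 : HasDerivAt (fun r : ℝ => s * (x μ + r) - x μ) s 0 := by
      simpa using (((hasDerivAt_id (0 : ℝ)).const_add (x μ)).const_mul s).sub_const (x μ)
    have h2 : HasDerivAt (fun r : ℝ => x μ + r) 1 0 := (hasDerivAt_id 0).const_add (x μ)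
    have h3 : HasDerivAt (fun r : ℝ => (r - 1) * x μ) (x μ) s := by
      simpa using ((hasDerivAt_id s).sub_const 1).mul_const (x μ)
    have h4 := h2.mul (HasDerivAt.comp_of_eq 0 hline h1 (by ring))
    have h5 := (hasDerivAt_id s).mul (hline.comp s h3)
    refine ((hasDerivAt_add_single (ContDiff.mul (by fun_prop) (hf.comp (by fun_prop))) μ
      x).unique ((h4.congr_of_eventuallyEq (.of_forall fun r => ?_)).congr_deriv ?_)).trans
      h5.deriv.symm
    · simp only [Pi.mul_apply, Function.comp, Pi.add_apply, Pi.smul_apply, Pi.single_eq_same,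
        smul_eq_mul, mul_one, add_assoc, ← add_smul]
      congr 4
      ring
    · have e : s * (x μ + 0) - x μ = (s - 1) * x μ := by ring
      simp only [Function.comp, e, id]
      ring
  simp only [h]
  rw [integral_Icc_eq_integral_Ioc, ← intervalIntegral.integral_of_le zero_le_one,
    intervalIntegral.integral_deriv_eq_sub (fun r _ => hs.differentiable (by simp) r)
      ((hs.continuous_deriv (by simp)).intervalIntegrable 0 1)]
  simp

end AxisPrimitive

section Conservation

variable {A : (Fin 4 → ℝ) → (Fin 4 → ℝ)}

theorem ContDiff.dPot (hA : ContDiff ℝ ∞ A) (μ ν : Fin 4) :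
    ContDiff ℝ ∞ fun x => dPot A x μ ν :=
  ((contDiff_pi.1 hA ν).pd μ).sub ((contDiff_pi.1 hA μ).pd ν)

theorem dPot_swap (A : (Fin 4 → ℝ) → (Fin 4 → ℝ)) (x : Fin 4 → ℝ) (μ ν : Fin 4) :
    dPot A x μ ν = -dPot A x ν μ := (neg_sub _ _).symm

theorem pd_dPot (hA : ContDiff ℝ ∞ A) (l μ ν : Fin 4) (x : Fin 4 → ℝ) :
    pd l (fun y => dPot A y μ ν) x =
      pd l (pd μ fun y => A y ν) x - pd l (pd ν fun y => A y μ) x :=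
  congrFun (pd_sub ((contDiff_pi.1 hA ν).pd μ) ((contDiff_pi.1 hA μ).pd ν) l) x

theorem bianchi_dPot (hA : ContDiff ℝ ∞ A) (l μ ν : Fin 4) (x : Fin 4 → ℝ) :
    pd l (fun y => dPot A y μ ν) x + pd μ (fun y => dPot A y ν l) x
      + pd ν (fun y => dPot A y l μ) x = 0 := by
  simp only [pd_dPot hA, pd_comm (contDiff_pi.1 hA ν) l μ, pd_comm (contDiff_pi.1 hA μ) l ν,
    pd_comm (contDiff_pi.1 hA l) μ ν]
  ring

theorem ContDiff.tem_dPot (hA : ContDiff ℝ ∞ A) (a b : Fin 4) :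
    ContDiff ℝ ∞ fun x => Tem (_root_.dPot A) x a b := by
  have h := fun μ ν => hA.dPot μ ν
  unfold Tem
  fun_prop

theorem pd_tem_dPot (hA : ContDiff ℝ ∞ A) (a b l : Fin 4) (x : Fin 4 → ℝ) :
    pd l (fun y => Tem (dPot A) y a b) x =
      -∑ c, η c c * (dPot A x a c * pd l (fun y => dPot A y b c) x
        + dPot A x b c * pd l (fun y => dPot A y a c) x)
      + (1 / 4) * (∑ c, ∑ d, η c c * η d d *
        (2 * dPot A x c d * pd l (fun y => dPot A y c d) x)) * η a b := by
  have hd : ∀ μ ν, HasFDerivAt (fun y => dPot A y μ ν) _ x := fun μ ν =>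
    ((hA.dPot μ ν).differentiable (by simp) x).hasFDerivAt
  have h := ((HasFDerivAt.fun_sum fun c (_ : c ∈ Finset.univ) =>
    ((hd a c).const_mul (η c c)).mul (hd b c)).neg).add
    (((HasFDerivAt.fun_sum fun c (_ : c ∈ Finset.univ) =>
      HasFDerivAt.fun_sum fun d (_ : d ∈ Finset.univ) =>
        ((hd c d).pow 2).const_mul (η c c * η d d)).const_mul (1 / 4)).mul_const (η a b))
  refine (DFunLike.congr_fun h.fderiv (Pi.single l 1)).trans ?_
  simp only [_root_.add_apply, _root_.neg_apply, _root_.smul_apply, _root_.sum_apply,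
    smul_eq_mul, nsmul_eq_mul, pd]
  have h1 : ∀ c, η c c * dPot A x a c * fderiv ℝ (fun y => dPot A y b c) x (Pi.single l 1)
      + dPot A x b c * (η c c * fderiv ℝ (fun y => dPot A y a c) x (Pi.single l 1)) = _ :=
    fun c => by rw [mul_left_comm, mul_assoc, ← mul_add]
  simp only [h1]
  rw [mul_comm (η a b)]
  simp

/-- The algebraic identity behind the conservation law: `F` is the field strength and `D l` its
derivative in the direction `l`. -/
theorem divergence_identity {F : Fin 4 → Fin 4 → ℝ} {D : Fin 4 → Fin 4 → Fin 4 → ℝ}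
    (hF : ∀ μ ν, F μ ν = -F ν μ) (hD : ∀ l μ ν, D l μ ν = -D l ν μ)
    (hB : ∀ l μ ν, D l μ ν + D μ ν l + D ν l μ = 0) (hM : ∀ ν, ∑ μ, η μ μ * D μ μ ν = 0)
    (a : Fin 4) :
    ∑ ν, η ν ν * (-∑ c, η c c * (F a c * D ν ν c + F ν c * D ν a c)
      + (1 / 4) * (∑ c, ∑ d, η c c * η d d * (2 * F c d * D ν c d)) * η a ν) = 0 := by
  have h1 : ∑ ν, η ν ν * ∑ c, η c c * (F a c * D ν ν c) = 0 := by
    simp only [Finset.mul_sum]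
    rw [Finset.sum_comm]
    refine Finset.sum_eq_zero fun c _ => ?_
    calc _ = η c c * F a c * ∑ ν, η ν ν * D ν ν c := by
          rw [Finset.mul_sum]
          exact Finset.sum_congr rfl fun ν _ => by ring
      _ = 0 := by rw [hM, mul_zero]
  have h2 : ∑ ν, η ν ν * ∑ c, η c c * (F ν c * D ν a c) =
      ∑ c, ∑ d, η c c * η d d * (1 / 2 * F c d * D a c d) := by
    have e1 : ∑ ν, ∑ c, η ν ν * η c c * (F ν c * D ν a c) =
        ∑ ν, ∑ c, η ν ν * η c c * (F ν c * D c ν a) := by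
      rw [Finset.sum_comm]
      refine Finset.sum_congr rfl fun ν _ => Finset.sum_congr rfl fun c _ => ?_
      rw [hF c ν, hD c a ν]
      ring
    have e2 : ∑ ν, ∑ c, η ν ν * η c c * (F ν c * (D ν a c + D c ν a - D a ν c)) = 0 := by
      refine Finset.sum_eq_zero fun ν _ => Finset.sum_eq_zero fun c _ => ?_
      linear_combination η ν ν * η c c * F ν c * (hB ν a c - hD a c ν)
    simp only [mul_add, mul_sub, Finset.sum_add_distrib, Finset.sum_sub_distrib, ← e1] at e2
    have e3 : ∑ c, ∑ d, η c c * η d d * (1 / 2 * F c d * D a c d) =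
        1 / 2 * ∑ c, ∑ d, η c c * η d d * (F c d * D a c d) := by
      simp only [Finset.mul_sum]
      exact Finset.sum_congr rfl fun c _ => Finset.sum_congr rfl fun d _ => by ring
    have e4 : ∑ ν, η ν ν * ∑ c, η c c * (F ν c * D ν a c) =
        ∑ ν, ∑ c, η ν ν * η c c * (F ν c * D ν a c) := by
      simp only [Finset.mul_sum, mul_assoc]
    linarith
  have h3 : ∑ ν, η ν ν * ((1 / 4) * (∑ c, ∑ d, η c c * η d d * (2 * F c d * D ν c d)) * η a ν) =
      ∑ c, ∑ d, η c c * η d d * (1 / 2 * F c d * D a c d) := by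
    have hη : η a a * η a a = 1 := by fin_cases a <;> simp [η]
    rw [Finset.sum_eq_single a (fun ν _ h => by simp [η, Matrix.diagonal_apply_ne _ h.symm])
      (by simp), mul_comm _ (η a a), ← mul_assoc, hη, one_mul, Finset.mul_sum]
    simp only [Finset.mul_sum]
    exact Finset.sum_congr rfl fun c _ => Finset.sum_congr rfl fun d _ => by ring
  simp only [mul_add, mul_neg, neg_add, Finset.sum_add_distrib, Finset.sum_neg_distrib] at *
  linarith

theorem sum_pd_tem_dPot (hA : ContDiff ℝ ∞ A)
    (hmaxwell : ∀ ν, ∀ x : Fin 4 → ℝ, ∑ μ, η μ μ * pd μ (fun y => dPot A y μ ν) x = 0)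
    (a : Fin 4) (x : Fin 4 → ℝ) :
    ∑ ν, η ν ν * pd ν (fun y => Tem (dPot A) y a ν) x = 0 := by
  have hD : ∀ l μ ν, pd l (fun y => dPot A y μ ν) x = -pd l (fun y => dPot A y ν μ) x :=
    fun l μ ν => by simp only [dPot_swap A _ μ ν, pd_neg]
  simp only [pd_tem_dPot hA]
  exact divergence_identity (D := fun l μ ν => pd l (fun y => dPot A y μ ν) x) (dPot_swap A x) hD
    (fun l μ ν => bianchi_dPot hA l μ ν x) (fun ν => hmaxwell ν x) a

end Conservation

theorem sum_eta_mul (g : Fin 4 → ℝ) : ∑ μ, η μ μ * g μ = g 0 - ∑ i : Fin 3, g i.succ := by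
  simp [Fin.sum_univ_succ (n := 3), η, Matrix.diagonal_apply_eq, Fin.sum_univ_three]
  ring

theorem codifferential_dPot {Γ : (Fin 4 → ℝ) → (Fin 4 → ℝ)} (hΓ : ContDiff ℝ ∞ Γ) (ν : Fin 4)
    (x : Fin 4 → ℝ) :
    ∑ μ, η μ μ * pd μ (fun y => dPot Γ y μ ν) x =
      dAlembert (fun y => Γ y ν) x
        - pd ν (fun y => ∑ μ, η μ μ * pd μ (fun z => Γ z μ) y) x := by
  have h := contDiff_pi.1 hΓ
  simp only [pd_dPot hΓ, mul_sub, Finset.sum_sub_distrib, dAlembert,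
    pd_sum fun μ _ => contDiff_const.mul ((h μ).pd μ), pd_const_mul ((h _).pd _)]
  simp only [fun μ => pd_comm (h μ) μ ν]

/-- A conserved current is the codifferential of an exact `2`-form. -/
theorem exists_codifferential_dPot_eq {J : (Fin 4 → ℝ) → (Fin 4 → ℝ)} (hJ : ContDiff ℝ ∞ J)
    (hcons : ∀ x, ∑ ν, η ν ν * pd ν (fun y => J y ν) x = 0) :
    ∃ Γ : (Fin 4 → ℝ) → (Fin 4 → ℝ), ContDiff ℝ ∞ Γ ∧
      ∀ ν x, ∑ μ, η μ μ * pd μ (fun y => dPot Γ y μ ν) x = J x ν := by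
  have hJ' := contDiff_pi.1 hJ
  obtain ⟨ψ, hψ, hψJ⟩ : ∃ ψ, ContDiff ℝ ∞ ψ ∧ pd 0 (pd 1 ψ) = fun y => J y 0 := by
    have h0 := contDiff_axisPrimitive (hJ' 0) 0
    refine ⟨axisPrimitive 1 (axisPrimitive 0 fun y => J y 0), contDiff_axisPrimitive h0 1, ?_⟩
    rw [pd_axisPrimitive h0, pd_axisPrimitive (hJ' 0)]
  have hψ1 := hψ.pd 1
  let δ : Fin 3 → ℝ := Pi.single 0 1
  let K : Fin 3 → (Fin 4 → ℝ) → ℝ := fun i y =>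
    J y i.succ - pd i.succ (pd 1 ψ) y - δ i * dAlembert ψ y
  have hK : ∀ i, ContDiff ℝ ∞ (K i) := fun i =>
    ((hJ' i.succ).sub (hψ1.pd i.succ)).sub (contDiff_const.mul hψ.dAlembert)
  have hdivK : (fun x => ∑ i, pd i.succ (K i) x) = 0 := by
    ext x
    have hpd : ∀ i, pd i.succ (K i) x = pd i.succ (fun y => J y i.succ) x
        - pd i.succ (pd i.succ (pd 1 ψ)) x - δ i * pd i.succ (dAlembert ψ) x := fun i => by
      simp only [K]
      rw [pd_sub ((hJ' i.succ).sub (hψ1.pd i.succ)) (contDiff_const.mul hψ.dAlembert),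
        pd_sub (hJ' i.succ) (hψ1.pd i.succ), pd_const_mul hψ.dAlembert]
    have hbox : pd 1 (dAlembert ψ) x = dAlembert (pd 1 ψ) x := by
      unfold dAlembert
      rw [pd_sum fun μ _ => contDiff_const.mul ((hψ.pd μ).pd μ)]
      refine Finset.sum_congr rfl fun μ _ => ?_
      rw [pd_const_mul ((hψ.pd μ).pd μ), pd_comm (hψ.pd μ), pd_comm hψ]
    have hc := hcons x
    rw [sum_eta_mul, ← hψJ] at hc
    have hb : dAlembert (pd 1 ψ) x = _ := sum_eta_mul fun μ => pd μ (pd μ (pd 1 ψ)) x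
    have hδ : ∑ i, δ i * pd i.succ (dAlembert ψ) x = pd 1 (dAlembert ψ) x := by
      simp [δ, Pi.single_apply]
    simp only [hpd, Finset.sum_sub_distrib, hδ, Pi.zero_apply]
    linarith
  let Γ : (Fin 4 → ℝ) → (Fin 4 → ℝ) := fun x =>
    Fin.cons 0 fun i => retarded (K i) x + δ i * ψ x
  have hΓi : ∀ i, ContDiff ℝ ∞ fun x => retarded (K i) x + δ i * ψ x := fun i =>
    (contDiff_retarded (hK i)).add (contDiff_const.mul hψ)
  have hΓ : ContDiff ℝ ∞ Γ := contDiff_pi.2 (Fin.cases contDiff_const hΓi)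
  have hgauge : (fun y => ∑ μ, η μ μ * pd μ (fun z => Γ z μ) y) = fun y => -pd 1 ψ y := by
    ext y
    have h0 : pd 0 (fun z => Γ z 0) y = 0 := congrFun (pd_const 0 0) y
    have hs : ∀ i : Fin 3, pd i.succ (fun z => Γ z i.succ) y =
        retarded (pd i.succ (K i)) y + δ i * pd i.succ ψ y := fun i => by
      rw [← pd_succ_retarded (hK i)]
      simp only [Γ, Fin.cons_succ, pd_add (contDiff_retarded (hK i)) (contDiff_const.mul hψ),
        pd_const_mul hψ]
    have hr : ∑ i, retarded (pd i.succ (K i)) y = 0 := by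
      rw [retarded_sum fun i _ => (hK i).pd i.succ, hdivK]
      simp [retarded]
    rw [sum_eta_mul, h0]
    simp only [hs, Finset.sum_add_distrib, hr]
    simp [δ, Pi.single_apply]
  refine ⟨Γ, hΓ, fun ν x => ?_⟩
  rw [codifferential_dPot hΓ, hgauge, pd_neg]
  cases ν using Fin.cases with
  | zero =>
    have h0 : dAlembert (fun y => Γ y 0) x = 0 := by
      simp [Γ, dAlembert, pd_const]
    rw [h0, hψJ]
    ring
  | succ i =>
    have hi : dAlembert (fun y => Γ y i.succ) x = K i x + δ i * dAlembert ψ x := by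
      rw [← dAlembert_retarded (hK i)]
      simp only [Γ, Fin.cons_succ, dAlembert, pd_add (contDiff_retarded (hK i))
        (contDiff_const.mul hψ), pd_const_mul hψ, pd_add ((contDiff_retarded (hK i)).pd _)
        (contDiff_const.mul (hψ.pd _)), pd_const_mul (hψ.pd _), mul_add,
        Finset.sum_add_distrib, Finset.mul_sum]
      congr 1
      exact Finset.sum_congr rfl fun μ _ => mul_left_comm _ _ _
    rw [hi]
    simp only [K]
    ring

/-- Maxwell-like equations for the energy–momentum of a free electromagnetic
field: each energy–momentum `1`-form of a free field is the codifferential of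
an exact `2`-form `W^a = dΓ^a`. -/
theorem energy_momentum_maxwell_like (A : (Fin 4 → ℝ) → (Fin 4 → ℝ))
    (hA : ContDiff ℝ (⊤ : ℕ∞) A)
    (hmaxwell : ∀ ν, ∀ x : Fin 4 → ℝ,
      ∑ μ : Fin 4, η μ μ * pd μ (fun y => dPot A y μ ν) x = 0)
    (a : Fin 4) :
    ∃ Γ : (Fin 4 → ℝ) → (Fin 4 → ℝ), ContDiff ℝ (⊤ : ℕ∞) Γ ∧
      ∀ ν, ∀ x : Fin 4 → ℝ,
        ∑ μ : Fin 4, η μ μ * pd μ (fun y => dPot Γ y μ ν) x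
          = Tem (dPot A) x a ν := by
  exact exists_codifferential_dPot_eq (J := fun x ν => Tem (dPot A) x a ν)
    (contDiff_pi.2 fun ν => hA.tem_dPot a ν) (sum_pd_tem_dPot hA hmaxwell a)
end
end
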